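/- arXiv:2012.12572 — 2 statements merged into one kernel-verified Lean document; each statement's English description precedes it below -/
import Mathlib

section
/- Let d ≥ 1 and λ ≥ 1. Suppose Φ is a real-valued C² function on a neighborhood of the closed ball B̄(0,2) ⊂ ℝ^d such that x ↦ ∇Φ(x) is injective on B(0,2) and L* := inf_{x ∈ B(0,2)} |det HΦ(x)| > 0. Then there is a constant C_d depending only on d such that for every k ∈ ℤ^d, Σ_{ν ∈ λ^{-1/2}ℤ^d ∩ B(0,2)} (1 + |k + λ^{1/2}∇Φ(ν)|)^{-d-1} ≤ C_d · (1/L*) · (1 + 𝒫₂^d), where the bound is uniform in k and λ. -/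
open MeasureTheory Metric Set

noncomputable section

/-- Euclidean space `ℝ^d`. -/
abbrev Euc (d : ℕ) : Type := EuclideanSpace ℝ (Fin d)

/-- Supremum over `s` of the norm of the `i`-th iterated (Fréchet) derivative of `f`. -/
noncomputable def supDeriv {d : ℕ} {F : Type*} [NormedAddCommGroup F] [NormedSpace ℝ F]
    (i : ℕ) (f : Euc d → F) (s : Set (Euc d)) : ℝ :=
  sSup ((fun x => ‖iteratedFDeriv ℝ i f x‖) '' s)

/-- The `C^k` norm of `f` on the set `s` (`k` a natural number):
sum of the sup-norms of all derivatives of order up to `k`. -/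
noncomputable def CnormNat {d : ℕ} {F : Type*} [NormedAddCommGroup F] [NormedSpace ℝ F]
    (k : ℕ) (f : Euc d → F) (s : Set (Euc d)) : ℝ :=
  ∑ j ∈ Finset.range (k + 1), supDeriv j f s

/-- The quantity `𝒫_r` (integer `r`): sizes of all derivatives of `Φ` of orders `2,…,r` on `s`. -/
noncomputable def Pnorm {d : ℕ} (r : ℕ) (Φ : Euc d → ℝ) (s : Set (Euc d)) : ℝ :=
  ∑ j ∈ Finset.Icc 2 r, supDeriv j Φ s

/-- The Hessian matrix of `Φ` at `x`. -/
noncomputable def Hess {d : ℕ} (Φ : Euc d → ℝ) (x : Euc d) : Matrix (Fin d) (Fin d) ℝ :=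
  Matrix.of fun i j =>
    iteratedFDeriv ℝ 2 Φ x ![EuclideanSpace.single i (1 : ℝ), EuclideanSpace.single j (1 : ℝ)]

/-- `L^*(Φ) = inf_{x ∈ s} |det HΦ(x)|`. -/
noncomputable def LStar {d : ℕ} (Φ : Euc d → ℝ) (s : Set (Euc d)) : ℝ :=
  sInf ((fun x => |(Hess Φ x).det|) '' s)

/-- The oscillatory integral `I(λ, Φ, ψ) = ∫ e^{iλΦ(x)} ψ(x) dx`. -/
noncomputable def oscInt {d : ℕ} (lam : ℝ) (Φ : Euc d → ℝ) (ψ : Euc d → ℂ) : ℂ :=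
  ∫ x : Euc d, Complex.exp (Complex.I * (lam : ℂ) * (Φ x : ℂ)) * ψ x

/-- Reinterpret a plain function `Fin d → ℝ` as a point of Euclidean space. -/
noncomputable def toEuc {d : ℕ} (v : Fin d → ℝ) : Euc d :=
  (EuclideanSpace.equiv (Fin d) ℝ).symm v

/-- The integral of `(1 + |z|)^{-d-1}` over `ℝ^d`. -/
def decayIntegral (d : ℕ) : ENNReal :=
  ∫⁻ z : Euc d, ENNReal.ofReal ((1 + ‖z‖) ^ (-(d : ℝ) - 1))

lemma decayIntegral_lt_top (d : ℕ) : decayIntegral d < ⊤ := by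
  have h := finite_integral_one_add_norm (E := Euc d) (μ := volume) (r := (d : ℝ) + 1)
    (by rw [finrank_euclideanSpace_fin]; linarith)
  rw [decayIntegral]
  convert h using 6
  ring

/-- A majorant for the values of `(1 + |·|)^{-d-1}` within distance `P` of a point. -/
def majorant (d : ℕ) (P : ℝ) (z : Euc d) : ENNReal :=
  (closedBall (0 : Euc d) (2 * P)).indicator 1 z +
    ENNReal.ofReal (2 ^ ((d : ℝ) + 1)) * ENNReal.ofReal ((1 + ‖z‖) ^ (-(d : ℝ) - 1))

lemma ofReal_decay_le_majorant {d : ℕ} {P : ℝ} {a b : Euc d} (h : ‖a - b‖ ≤ P) :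
    ENNReal.ofReal ((1 + ‖a‖) ^ (-(d : ℝ) - 1)) ≤ majorant d P b := by
  have hd : -(d : ℝ) - 1 ≤ 0 := by linarith [d.cast_nonneg (α := ℝ)]
  by_cases hb : b ∈ closedBall (0 : Euc d) (2 * P)
  · rw [majorant, indicator_of_mem hb]
    refine le_trans ?_ le_self_add
    rw [Pi.one_apply, ENNReal.ofReal_le_one]
    exact Real.rpow_le_one_of_one_le_of_nonpos (by linarith [norm_nonneg a]) hd
  · rw [majorant, ← ENNReal.ofReal_mul (by positivity)]
    refine le_trans (ENNReal.ofReal_le_ofReal ?_) le_add_self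
    rw [mem_closedBall_zero_iff, not_le] at hb
    have h1 : ‖b‖ ≤ ‖a‖ + ‖a - b‖ := norm_le_norm_add_norm_sub _ _
    calc (1 + ‖a‖) ^ (-(d : ℝ) - 1) ≤ ((1 + ‖b‖) / 2) ^ (-(d : ℝ) - 1) :=
          Real.rpow_le_rpow_of_nonpos (by positivity) (by linarith) hd
      _ = 2 ^ ((d : ℝ) + 1) * (1 + ‖b‖) ^ (-(d : ℝ) - 1) := by
          rw [Real.div_rpow (by positivity) (by positivity),
            show -(d : ℝ) - 1 = -((d : ℝ) + 1) by ring, Real.rpow_neg (by positivity) ((d : ℝ) + 1),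
            Real.rpow_neg (x := 2) (by positivity) ((d : ℝ) + 1)]
          field_simp

lemma lintegral_majorant {d : ℕ} {P : ℝ} (hP : 0 ≤ P) :
    ∫⁻ z, majorant d P z = ENNReal.ofReal ((2 * P) ^ d) * volume (ball (0 : Euc d) 1) +
      ENNReal.ofReal (2 ^ ((d : ℝ) + 1)) * decayIntegral d := by
  simp only [majorant]
  rw [lintegral_add_left (measurable_one.indicator measurableSet_closedBall),
    lintegral_indicator_one measurableSet_closedBall,
    lintegral_const_mul' _ _ ENNReal.ofReal_ne_top, decayIntegral,
    Measure.addHaar_closedBall _ _ (by positivity), finrank_euclideanSpace_fin]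

lemma inv_le_norm_sub_lattice {d : ℕ} {r : ℝ} (hr : 0 < r) {m n : Fin d → ℤ} (hmn : m ≠ n) :
    r⁻¹ ≤ ‖toEuc (fun i => r⁻¹ * (m i : ℝ)) - toEuc (fun i => r⁻¹ * (n i : ℝ))‖ := by
  obtain ⟨i, hi⟩ := Function.ne_iff.mp hmn
  have h1 : (1 : ℝ) ≤ |(m i : ℝ) - n i| := by
    exact_mod_cast Int.one_le_abs (sub_ne_zero.mpr hi)
  refine le_trans ?_ (PiLp.norm_apply_le _ i)
  have h2 : (toEuc (fun i => r⁻¹ * (m i : ℝ)) - toEuc (fun i => r⁻¹ * (n i : ℝ))) i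
      = r⁻¹ * ((m i : ℝ) - n i) := by
    simp [toEuc, mul_sub]
  rw [h2, Real.norm_eq_abs, abs_mul, abs_of_pos (inv_pos.mpr hr)]
  exact le_mul_of_one_le_right (by positivity) h1

lemma norm_sub_lt_of_mem_ball_shrink {d : ℕ} {ν y : Euc d} {s : ℝ} (hs : 0 < s)
    (hν : ‖ν‖ < 2) (hy : y ∈ ball ((1 - s) • ν) s) : ‖y - ν‖ < 3 * s := by
  rw [mem_ball_iff_norm] at hy
  have h1 : y - ν = (y - (1 - s) • ν) + (-s) • ν := by module
  calc ‖y - ν‖ ≤ ‖y - (1 - s) • ν‖ + ‖(-s) • ν‖ := h1 ▸ norm_add_le _ _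
    _ < s + s * 2 := by
      rw [norm_smul, norm_neg, Real.norm_of_nonneg hs.le]
      nlinarith
    _ = 3 * s := by ring

lemma ball_shrink_subset {d : ℕ} {ν : Euc d} {s : ℝ} (hs : 0 < s) (hs1 : s ≤ 1)
    (hν : ‖ν‖ < 2) : ball ((1 - s) • ν) s ⊆ ball 0 2 := by
  refine ball_subset_ball' ?_
  rw [dist_zero_right, norm_smul, Real.norm_of_nonneg (by linarith)]
  nlinarith

lemma lintegral_comp_le_of_injOn {d : ℕ} {f : Euc d → Euc d} {f' : Euc d → Euc d →L[ℝ] Euc d}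
    {L : ℝ} {s : Set (Euc d)} (hs : MeasurableSet s)
    (hf : ∀ x ∈ s, HasFDerivAt f (f' x) x) (hdet : ∀ x ∈ s, L ≤ |(f' x).det|)
    (hinj : InjOn f s) (g : Euc d → ENNReal) :
    ENNReal.ofReal L * ∫⁻ x in s, g (f x) ≤ ∫⁻ z, g z := by
  calc ENNReal.ofReal L * ∫⁻ x in s, g (f x)
      = ∫⁻ x in s, ENNReal.ofReal L * g (f x) :=
        (lintegral_const_mul' _ _ ENNReal.ofReal_ne_top).symm
    _ ≤ ∫⁻ x in s, ENNReal.ofReal |(f' x).det| * g (f x) :=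
        setLIntegral_mono' hs fun x hx => by gcongr; exact hdet x hx
    _ = ∫⁻ z in f '' s, g z :=
        (lintegral_image_eq_lintegral_abs_det_fderiv_mul volume hs
          (fun x hx => (hf x hx).hasFDerivWithinAt) hinj g).symm
    _ ≤ ∫⁻ z, g z := setLIntegral_le_lintegral _ _

lemma sum_volume_mul_le_lintegral {d : ℕ} {f : Euc d → Euc d}
    {f' : Euc d → Euc d →L[ℝ] Euc d} {r P : ℝ} (hr : 1 ≤ r)
    (hf : ∀ x ∈ ball (0 : Euc d) 2, HasFDerivAt f (f' x) x)
    (hP : ∀ x ∈ ball (0 : Euc d) 2, ‖f' x‖ ≤ r * P) (F : Finset (Fin d → ℤ))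
    (hF : ∀ m ∈ F, ‖toEuc (fun i => r⁻¹ * (m i : ℝ))‖ < 2) :
    (∑ m ∈ F, ENNReal.ofReal
        ((1 + ‖f (toEuc (fun i => r⁻¹ * (m i : ℝ)))‖) ^ (-(d : ℝ) - 1))) *
        volume (ball (0 : Euc d) (r⁻¹ / 6)) ≤
      ∫⁻ y in ball (0 : Euc d) 2, majorant d P (f y) := by
  set ν : (Fin d → ℤ) → Euc d := fun m => toEuc (fun i => r⁻¹ * (m i : ℝ)) with hν
  set s : ℝ := r⁻¹ / 6 with hs_def
  have hr0 : 0 < r := by linarith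
  have hs : 0 < s := by positivity
  have hs6 : 6 * s = r⁻¹ := by rw [hs_def]; ring
  have hs1 : s ≤ 1 := by linarith [inv_le_one_of_one_le₀ hr]
  have hP0 : 0 ≤ r * P := (norm_nonneg _).trans (hP 0 (by simp))
  have hsub : ∀ m ∈ F, ball ((1 - s) • ν m) s ⊆ ball 0 2 := fun m hm =>
    ball_shrink_subset hs hs1 (hF m hm)
  have hdisj : (F : Set (Fin d → ℤ)).PairwiseDisjoint fun m => ball ((1 - s) • ν m) s := by
    intro m hm n hn hmn
    refine disjoint_left.mpr fun y hy hy' => ?_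
    have h1 := norm_sub_lt_of_mem_ball_shrink hs (hF m hm) hy
    have h2 := norm_sub_lt_of_mem_ball_shrink hs (hF n hn) hy'
    have h3 : r⁻¹ ≤ ‖ν m - ν n‖ := inv_le_norm_sub_lattice hr0 hmn
    have h4 : ‖ν m - ν n‖ ≤ ‖y - ν m‖ + ‖y - ν n‖ := by
      rw [norm_sub_rev y (ν m)]
      exact norm_sub_le_norm_sub_add_norm_sub _ _ _
    linarith
  have hclose : ∀ m ∈ F, ∀ y ∈ ball ((1 - s) • ν m) s, ‖f (ν m) - f y‖ ≤ P := by
    intro m hm y hy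
    have h1 := norm_sub_lt_of_mem_ball_shrink hs (hF m hm) hy
    have h2 := (convex_ball (0 : Euc d) 2).norm_image_sub_le_of_norm_hasFDerivWithin_le
      (fun x hx => (hf x hx).hasFDerivWithinAt) hP (hsub m hm hy)
      (mem_ball_zero_iff.mpr (hF m hm))
    rw [norm_sub_rev (ν m) y] at h2
    calc ‖f (ν m) - f y‖ ≤ r * P * ‖y - ν m‖ := h2
      _ ≤ r * P * r⁻¹ := by gcongr; linarith
      _ = P := by field_simp
  rw [Finset.sum_mul]
  calc ∑ m ∈ F, ENNReal.ofReal ((1 + ‖f (ν m)‖) ^ (-(d : ℝ) - 1)) *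
        volume (ball (0 : Euc d) s)
      ≤ ∑ m ∈ F, ∫⁻ y in ball ((1 - s) • ν m) s, majorant d P (f y) := by
        refine Finset.sum_le_sum fun m hm => ?_
        rw [← Measure.addHaar_ball_center volume ((1 - s) • ν m) s, ← setLIntegral_const]
        exact setLIntegral_mono' measurableSet_ball fun y hy =>
          ofReal_decay_le_majorant (hclose m hm y hy)
    _ = ∫⁻ y in ⋃ m ∈ F, ball ((1 - s) • ν m) s, majorant d P (f y) :=
        (lintegral_biUnion_finset hdisj (fun _ _ => measurableSet_ball) _).symm
    _ ≤ ∫⁻ y in ball (0 : Euc d) 2, majorant d P (f y) :=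
        lintegral_mono_set (iUnion₂_subset hsub)

lemma sum_decay_le {d : ℕ} {f : Euc d → Euc d} {f' : Euc d → Euc d →L[ℝ] Euc d}
    {r P L : ℝ} (hr : 1 ≤ r) (hP0 : 0 ≤ P) (hL : 0 < L)
    (hf : ∀ x ∈ ball (0 : Euc d) 2, HasFDerivAt f (f' x) x)
    (hP : ∀ x ∈ ball (0 : Euc d) 2, ‖f' x‖ ≤ P)
    (hdet : ∀ x ∈ ball (0 : Euc d) 2, L ≤ |(f' x).det|)
    (hinj : InjOn f (ball 0 2)) (k : Euc d) (F : Finset (Fin d → ℤ))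
    (hF : ∀ m ∈ F, ‖toEuc (fun i => r⁻¹ * (m i : ℝ))‖ < 2) :
    (∑ m ∈ F, (1 + ‖k + r • f (toEuc (fun i => r⁻¹ * (m i : ℝ)))‖) ^ (-(d : ℝ) - 1)) *
        (volume.real (ball (0 : Euc d) 1) * L) ≤
      6 ^ d * ((2 * P) ^ d * volume.real (ball (0 : Euc d) 1) +
        2 ^ ((d : ℝ) + 1) * (decayIntegral d).toReal) := by
  have hr0 : 0 < r := by linarith
  have hg : ∀ x ∈ ball (0 : Euc d) 2, HasFDerivAt (fun y => k + r • f y) (r • f' x) x :=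
    fun x hx => ((hf x hx).const_smul r).const_add k
  have hgP : ∀ x ∈ ball (0 : Euc d) 2, ‖r • f' x‖ ≤ r * P := fun x hx => by
    rw [norm_smul, Real.norm_of_nonneg hr0.le]
    gcongr
    exact hP x hx
  have hgdet : ∀ x ∈ ball (0 : Euc d) 2, r ^ d * L ≤ |(r • f' x).det| := fun x hx => by
    have h : (r • f' x).det = r ^ d * (f' x).det := by
      rw [ContinuousLinearMap.det, ContinuousLinearMap.toLinearMap_smul, LinearMap.det_smul,
        finrank_euclideanSpace_fin]
    rw [h, abs_mul, abs_of_pos (pow_pos hr0 d)]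
    gcongr
    exact hdet x hx
  have hginj : InjOn (fun y => k + r • f y) (ball 0 2) := fun x hx y hy hxy =>
    hinj hx hy (smul_right_injective _ hr0.ne' (add_left_cancel hxy))
  have h1 := sum_volume_mul_le_lintegral hr hg hgP F hF
  have h2 := (mul_le_mul_right h1 (ENNReal.ofReal (r ^ d * L))).trans
    (lintegral_comp_le_of_injOn measurableSet_ball hg hgdet hginj (majorant d P))
  rw [lintegral_majorant hP0, Measure.addHaar_ball_of_pos _ _ (by positivity),
    finrank_euclideanSpace_fin, ← ENNReal.ofReal_sum_of_nonneg (fun _ _ => by positivity)] at h2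
  have hJ := (decayIntegral_lt_top d).ne
  have hv : volume (ball (0 : Euc d) 1) ≠ ⊤ := measure_ball_lt_top.ne
  have h3 := ENNReal.toReal_mono (by finiteness) h2
  rw [ENNReal.toReal_add (by finiteness) (by finiteness)] at h3
  simp only [ENNReal.toReal_mul] at h3
  rw [ENNReal.toReal_ofReal (by positivity), ENNReal.toReal_ofReal (by positivity),
    ENNReal.toReal_ofReal (by positivity), ENNReal.toReal_ofReal (by positivity),
    ENNReal.toReal_ofReal (by positivity), ← measureReal_def] at h3
  refine le_trans (le_of_eq ?_) (mul_le_mul_of_nonneg_left h3 (by positivity : (0 : ℝ) ≤ 6 ^ d))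
  rw [div_pow, inv_pow]
  field_simp

/-- The Riesz isomorphism from the dual of `ℝ^d`, as a linear isometry. -/
def rieszEquiv (d : ℕ) : (Euc d →L[ℝ] ℝ) ≃ₗᵢ[ℝ] Euc d where
  toEquiv := (InnerProductSpace.toDual ℝ (Euc d)).symm.toEquiv
  map_add' := map_add (InnerProductSpace.toDual ℝ (Euc d)).symm
  map_smul' c x := map_smulₛₗ (InnerProductSpace.toDual ℝ (Euc d)).symm c x
  norm_map' := (InnerProductSpace.toDual ℝ (Euc d)).symm.norm_map

lemma rieszEquiv_apply_coord {d : ℕ} (l : Euc d →L[ℝ] ℝ) (i : Fin d) :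
    rieszEquiv d l i = l (EuclideanSpace.single i 1) := by
  have h : inner ℝ (rieszEquiv d l) (EuclideanSpace.single i (1 : ℝ)) =
      l (EuclideanSpace.single i 1) := InnerProductSpace.toDual_symm_apply
  rw [← h, EuclideanSpace.inner_single_right]
  simp

/-- The derivative of the gradient of `Φ`. -/
def gradientDeriv {d : ℕ} (Φ : Euc d → ℝ) (x : Euc d) : Euc d →L[ℝ] Euc d :=
  (rieszEquiv d).toLinearIsometry.toContinuousLinearMap.comp (fderiv ℝ (fderiv ℝ Φ) x)

lemma hasFDerivAt_gradient {d : ℕ} {Φ : Euc d → ℝ} {x : Euc d} (h : ContDiffAt ℝ 2 Φ x) :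
    HasFDerivAt (gradient Φ) (gradientDeriv Φ x) x := by
  have h1 : DifferentiableAt ℝ (fderiv ℝ Φ) x :=
    (h.fderiv_right (m := 1) (by norm_num)).differentiableAt (by norm_num)
  exact (rieszEquiv d).toLinearIsometry.toContinuousLinearMap.hasFDerivAt.comp x h1.hasFDerivAt

lemma det_Hess {d : ℕ} (Φ : Euc d → ℝ) (x : Euc d) :
    (Hess Φ x).det = (gradientDeriv Φ x).det := by
  have h : (gradientDeriv Φ x).det =
      LinearMap.det (gradientDeriv Φ x : Euc d →ₗ[ℝ] Euc d) := rfl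
  rw [h, ← LinearMap.det_toMatrix (EuclideanSpace.basisFun (Fin d) ℝ).toBasis,
    ← Matrix.det_transpose]
  congr 1
  ext i j
  simp [Hess, LinearMap.toMatrix_apply, iteratedFDeriv_two_apply, gradientDeriv,
    rieszEquiv_apply_coord]

lemma norm_gradientDeriv {d : ℕ} (Φ : Euc d → ℝ) (x : Euc d) :
    ‖gradientDeriv Φ x‖ = ‖iteratedFDeriv ℝ 2 Φ x‖ := by
  rw [gradientDeriv, LinearIsometry.norm_toContinuousLinearMap_comp,
    ← norm_iteratedFDeriv_fderiv, ← norm_iteratedFDeriv_fderiv, norm_iteratedFDeriv_zero]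

lemma norm_iteratedFDeriv_le_Pnorm {d : ℕ} {Φ : Euc d → ℝ} {U : Set (Euc d)} (hU : IsOpen U)
    (hUb : closedBall 0 2 ⊆ U) (hΦ : ContDiffOn ℝ (2 : ℕ) Φ U) {x : Euc d}
    (hx : x ∈ ball (0 : Euc d) 2) : ‖iteratedFDeriv ℝ 2 Φ x‖ ≤ Pnorm 2 Φ (ball 0 2) := by
  have hcont : ContinuousOn (fun y => ‖iteratedFDeriv ℝ 2 Φ y‖) (closedBall 0 2) := fun y hy =>
    ((hΦ.contDiffAt (hU.mem_nhds (hUb hy))).continuousAt_iteratedFDeriv le_rfl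
      ).norm.continuousWithinAt
  have hbdd := ((isCompact_closedBall (0 : Euc d) 2).bddAbove_image hcont).mono
    (image_mono ball_subset_closedBall)
  simpa [Pnorm, supDeriv] using le_csSup hbdd (mem_image_of_mem _ hx)

/-- Lemma `k-sum`: the sum over lattice points `ν ∈ λ^{-1/2}ℤ^d ∩ B(0,2)`
of `(1 + |k + λ^{1/2}∇Φ(ν)|)^{-d-1}` is bounded by `C_d (1/L^*) (1 + 𝒫₂^d)`,
uniformly in `k ∈ ℤ^d` and `λ ≥ 1`. -/
theorem stmt8 (d : ℕ) (hd : 1 ≤ d) :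
    ∃ C : ℝ, 0 < C ∧
      ∀ (lam : ℝ) (Φ : Euc d → ℝ) (U : Set (Euc d)) (k : Fin d → ℤ),
        1 ≤ lam →
        IsOpen U → closedBall 0 2 ⊆ U →
        ContDiffOn ℝ (2 : ℕ) Φ U →
        Set.InjOn (gradient Φ) (ball 0 2) →
        0 < LStar Φ (ball 0 2) →
        (∑' m : Fin d → ℤ,
            if ‖toEuc (fun i => (Real.sqrt lam)⁻¹ * (m i : ℝ))‖ < 2 then
              (1 + ‖toEuc (fun i => (k i : ℝ)) +
                  Real.sqrt lam •
                    gradient Φ (toEuc (fun i => (Real.sqrt lam)⁻¹ * (m i : ℝ)))‖) ^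
                (-(d : ℝ) - 1)
            else 0) ≤
          C * (1 / LStar Φ (ball 0 2)) * (1 + Pnorm 2 Φ (ball 0 2) ^ d) := by
  set v : ℝ := volume.real (ball (0 : Euc d) 1) with hv
  set J : ℝ := (decayIntegral d).toReal with hJ
  have hv0 : 0 < v := ENNReal.toReal_pos (measure_ball_pos _ _ one_pos).ne' measure_ball_lt_top.ne
  have hJ0 : 0 ≤ J := ENNReal.toReal_nonneg
  refine ⟨6 ^ d * (2 ^ d * v + 2 ^ ((d : ℝ) + 1) * J) / v, by positivity, ?_⟩
  intro lam Φ U k hlam hU hUb hΦ hinj hL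
  have hP := fun x hx => norm_iteratedFDeriv_le_Pnorm hU hUb hΦ (x := x) hx
  have hP0 : 0 ≤ Pnorm 2 Φ (ball 0 2) := (norm_nonneg _).trans (hP 0 (by simp))
  have hdet : ∀ x ∈ ball (0 : Euc d) 2, LStar Φ (ball 0 2) ≤ |(Hess Φ x).det| := fun x hx =>
    csInf_le ⟨0, by rintro _ ⟨y, -, rfl⟩; exact abs_nonneg _⟩ (mem_image_of_mem _ hx)
  refine Real.tsum_le_of_sum_le (fun m => ?_) fun s => ?_
  · dsimp only [Pi.zero_apply]
    split_ifs <;> positivity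
  rw [← Finset.sum_filter]
  have h := sum_decay_le (Real.one_le_sqrt.mpr hlam) hP0 hL
    (fun x hx => hasFDerivAt_gradient
      (hΦ.contDiffAt (hU.mem_nhds (hUb (ball_subset_closedBall hx)))))
    (fun x hx => (norm_gradientDeriv Φ x).trans_le (hP x hx))
    (fun x hx => (hdet x hx).trans_eq (by rw [det_Hess])) hinj
    (toEuc (fun i => (k i : ℝ)))
    (s.filter fun m => ‖toEuc (fun i => (Real.sqrt lam)⁻¹ * (m i : ℝ))‖ < 2)
    (fun m hm => (Finset.mem_filter.mp hm).2)
  rw [← hv, ← hJ, ← le_div_iff₀ (by positivity)] at h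
  refine h.trans ?_
  generalize LStar Φ (ball 0 2) = L at *
  generalize Pnorm 2 Φ (ball 0 2) = P at *
  rw [show 6 ^ d * (2 ^ d * v + 2 ^ ((d : ℝ) + 1) * J) / v * (1 / L) * (1 + P ^ d) =
    6 ^ d * ((2 ^ d * v + 2 ^ ((d : ℝ) + 1) * J) * (1 + P ^ d)) / (v * L) by
      field_simp]
  rw [mul_pow]
  gcongr
  have h1 : 0 ≤ 2 ^ ((d : ℝ) + 1) * J * P ^ d := by positivity
  have h2 : 0 ≤ 2 ^ d * v := by positivity
  linarith

end
end

section
/- Let d ≥ 1 and let Φ be a real-valued C³ function on a neighborhood of B̄(0,1) ⊂ ℝ^d satisfying |∇Φ(x) − ∇Φ(y)| ≥ μ|x − y| for all x, y ∈ B̄(0,1) for some μ > 0. Set λ₀ := 𝒫₃² 𝒫₂ μ^{-4} and λ₁ := 2⁸ d⁸ λ₀, and suppose λ ≥ λ₁. Let 𝓘_λ ⊂ B̄(0,1) be a finite collection such that for any distinct ν, σ ∈ 𝓘_λ, either ν ∉ σ + λ^{-1/2}T_σ(B(0,1)) or σ ∉ ν + λ^{-1/2}T_ν(B(0,1)). Then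 there exists N₀ depending only on d such that every x ∈ ℝ^d is contained in at most N₀ of the sets 2B_ν := ν + λ^{-1/2}T_ν(B(0,2)), ν ∈ 𝓘_λ. -/
open MeasureTheory Metric Set

noncomputable section

/-- Apply a matrix to a Euclidean vector. -/
noncomputable def mulVecE {d : ℕ} (M : Matrix (Fin d) (Fin d) ℝ) (x : Euc d) : Euc d :=
  (EuclideanSpace.equiv (Fin d) ℝ).symm (M.mulVec (EuclideanSpace.equiv (Fin d) ℝ x))

/-- `T = |HΦ(ν)|^{-1/2}`, characterized as the unique symmetric positive definite matrix
with `HΦ(ν)² ⬝ T⁴ = 1` (positive definiteness includes symmetry). -/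
def IsAbsInvSqrtHess {d : ℕ} (Φ : Euc d → ℝ) (ν : Euc d)
    (T : Matrix (Fin d) (Fin d) ℝ) : Prop :=
  T.PosDef ∧ (Hess Φ ν * Hess Φ ν) * (T * T * T * T) = 1

/-- The ellipsoid `ν + λ^{-1/2} T(B(0,r))`. -/
noncomputable def packet {d : ℕ} (lam : ℝ) (T : Matrix (Fin d) (Fin d) ℝ) (ν : Euc d)
    (r : ℝ) : Set (Euc d) :=
  (fun y => ν + (Real.sqrt lam)⁻¹ • mulVecE T y) '' ball 0 r

section FiniteOverlap

open scoped RealInnerProductSpace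

lemma mulVecE_mul {d : ℕ} (A B : Matrix (Fin d) (Fin d) ℝ) (x : Euc d) :
    mulVecE (A * B) x = mulVecE A (mulVecE B x) := by
  ext i
  exact congrFun (Matrix.mulVec_mulVec x.ofLp A B).symm i

lemma mulVecE_one {d : ℕ} (x : Euc d) :
    mulVecE (1 : Matrix (Fin d) (Fin d) ℝ) x = x := by
  ext i
  simp [mulVecE]

lemma mulVecE_sub {d : ℕ} (A : Matrix (Fin d) (Fin d) ℝ) (x y : Euc d) :
    mulVecE A (x - y) = mulVecE A x - mulVecE A y := by
  ext i
  simp [mulVecE, Matrix.mulVec_sub]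

lemma mulVecE_smul {d : ℕ} (A : Matrix (Fin d) (Fin d) ℝ) (c : ℝ) (x : Euc d) :
    mulVecE A (c • x) = c • mulVecE A x := by
  ext i
  simp [mulVecE, Matrix.mulVec_smul]

lemma inner_mulVecE_comm {d : ℕ} {A : Matrix (Fin d) (Fin d) ℝ} (hA : A.IsHermitian)
    (x y : Euc d) : ⟪mulVecE A x, y⟫ = ⟪x, mulVecE A y⟫ :=
  Matrix.isSymmetric_toEuclideanLin_iff.mpr hA x y

/-- Operator monotonicity of the square root, in terms of quadratic forms. -/
lemma inner_mulVecE_le_of_norm_le {d : ℕ} {P Q : Matrix (Fin d) (Fin d) ℝ}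
    (hP : P.IsHermitian) (hQ : Q.IsHermitian) (hQ0 : ∀ w : Euc d, 0 ≤ ⟪w, mulVecE Q w⟫)
    (h : ∀ w : Euc d, ‖mulVecE P w‖ ≤ ‖mulVecE Q w‖) (w : Euc d) :
    ⟪w, mulVecE P w⟫ ≤ ⟪w, mulVecE Q w⟫ := by
  have hR : (Q - P).IsHermitian := hQ.sub hP
  have hsub : ∀ v : Euc d, mulVecE (Q - P) v = mulVecE Q v - mulVecE P v := fun v => by
    ext i
    simp [mulVecE, Matrix.sub_mulVec]
  have hpsd : (Q - P).PosSemidef := by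
    rw [hR.posSemidef_iff_eigenvalues_nonneg]
    intro i
    by_contra! hneg
    simp only [Pi.zero_apply] at hneg
    set v : Euc d := hR.eigenvectorBasis i
    set s := hR.eigenvalues i
    have hn : ‖v‖ = 1 := hR.eigenvectorBasis.orthonormal.1 i
    have hev : mulVecE (Q - P) v = s • v := by
      have := hR.mulVec_eigenvectorBasis i
      ext k
      exact congrFun this k
    have hPv : mulVecE P v = mulVecE Q v - s • v := by
      rw [← hev, hsub]; abel
    have h1 := h v
    have h2 : ‖mulVecE P v‖ ^ 2 = ‖mulVecE Q v‖ ^ 2 - 2 * (s * ⟪v, mulVecE Q v⟫) + s ^ 2 := by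
      rw [hPv, norm_sub_sq_real, inner_smul_right, norm_smul, hn, real_inner_comm, mul_one,
        Real.norm_eq_abs, sq_abs]
    have h3 := mul_nonneg_of_nonpos_of_nonpos hneg.le (neg_nonpos.mpr (hQ0 v))
    have h4 : ‖mulVecE P v‖ ^ 2 ≤ ‖mulVecE Q v‖ ^ 2 := by gcongr
    nlinarith [sq_pos_of_neg hneg]
  have := (Matrix.isPositive_toEuclideanLin_iff.mpr hpsd).re_inner_nonneg_right w
  have h' : 0 ≤ ⟪w, mulVecE (Q - P) w⟫ := this
  rw [hsub, inner_sub_right] at h'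
  linarith

/-- Separated subsets of a compact set have bounded cardinality. -/
lemma exists_card_le_of_separated {α : Type*} [PseudoMetricSpace α] [Nonempty α] {K : Set α}
    (hK : IsCompact K) {ε : ℝ} (hε : 0 < ε) :
    ∃ N : ℕ, ∀ {ι : Type} (J : Finset ι) (u : ι → α), (∀ i ∈ J, u i ∈ K) →
      (∀ i ∈ J, ∀ j ∈ J, i ≠ j → ε ≤ dist (u i) (u j)) → J.card ≤ N := by
  obtain ⟨t, -, htf, hcov⟩ := hK.finite_cover_balls (half_pos hε)
  refine ⟨htf.toFinset.card, fun {ι} J u hu hsep => ?_⟩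
  have hex : ∀ i ∈ J, ∃ c ∈ t, dist (u i) c < ε / 2 := fun i hi => by
    simpa using hcov (hu i hi)
  choose! c hct hc using hex
  refine Finset.card_le_card_of_injOn c (fun i hi => by simpa using hct i hi) ?_
  intro i hi j hj hij
  by_contra hne
  have h1 := hsep i hi j hj hne
  have h2 := dist_triangle_right (u i) (u j) (c i)
  have h3 := hc i hi
  have h4 := hc j hj
  rw [← hij] at h4
  linarith

lemma inner_mulVecE_hess {d : ℕ} (Φ : Euc d → ℝ) (x v w : Euc d) :
    ⟪v, mulVecE (Hess Φ x) w⟫ = fderiv ℝ (fderiv ℝ Φ) x v w := by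
  have hexp : ∀ u : Euc d, u = ∑ i, u i • EuclideanSpace.single i (1 : ℝ) := fun u => by
    simpa using ((EuclideanSpace.basisFun (Fin d) ℝ).sum_repr u).symm
  conv_rhs => rw [hexp v, hexp w]
  simp only [map_sum, map_smul, sum_apply, smul_apply,
    smul_eq_mul]
  simp only [PiLp.inner_apply, mulVecE, Hess, iteratedFDeriv_two_apply]
  simp [Matrix.mulVec, dotProduct, Finset.mul_sum, mul_comm, mul_left_comm]
  exact Finset.sum_comm

lemma norm_le_of_inner_le {E : Type*} [NormedAddCommGroup E] [InnerProductSpace ℝ E] {z : E}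
    {C : ℝ} (hC : 0 ≤ C) (h : ∀ v, ⟪v, z⟫ ≤ C * ‖v‖) : ‖z‖ ≤ C := by
  by_cases hz : z = 0
  · simpa [hz] using hC
  · have := h z
    rw [real_inner_self_eq_norm_mul_norm] at this
    exact le_of_mul_le_mul_right this (norm_pos_iff.mpr hz)

lemma supDeriv_nonneg {d : ℕ} {F : Type*} [NormedAddCommGroup F] [NormedSpace ℝ F] (i : ℕ)
    (f : Euc d → F) (s : Set (Euc d)) : 0 ≤ supDeriv i f s :=
  Real.sSup_nonneg (forall_mem_image.mpr fun _ _ => norm_nonneg _)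

lemma continuousOn_iteratedFDeriv_of_isOpen {E F : Type*} [NormedAddCommGroup E] [NormedSpace ℝ E]
    [NormedAddCommGroup F] [NormedSpace ℝ F] {f : E → F} {U : Set E} {n m : ℕ}
    (hf : ContDiffOn ℝ n f U) (hU : IsOpen U) (hm : m ≤ n) :
    ContinuousOn (iteratedFDeriv ℝ m f) U :=
  (hf.continuousOn_iteratedFDerivWithin (mod_cast hm) hU.uniqueDiffOn).congr
    fun _ hx => (iteratedFDerivWithin_of_isOpen m hU hx).symm

lemma norm_iteratedFDeriv_le_supDeriv {d n j : ℕ} {Φ : Euc d → ℝ} {U : Set (Euc d)}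
    (hU : IsOpen U) (hBU : closedBall 0 1 ⊆ U) (hΦ : ContDiffOn ℝ n Φ U) (hj : j ≤ n)
    {x : Euc d} (hx : x ∈ closedBall (0 : Euc d) 1) :
    ‖iteratedFDeriv ℝ j Φ x‖ ≤ supDeriv j Φ (ball 0 1) := by
  have hc : ContinuousOn (fun x => ‖iteratedFDeriv ℝ j Φ x‖) (closedBall 0 1) :=
    ((continuousOn_iteratedFDeriv_of_isOpen hΦ hU hj).mono hBU).norm
  have hbdd : BddAbove ((fun x => ‖iteratedFDeriv ℝ j Φ x‖) '' ball 0 1) :=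
    ((isCompact_closedBall 0 1).bddAbove_image hc).mono (image_mono ball_subset_closedBall)
  rw [← closure_ball (0 : Euc d) one_ne_zero] at hx hc
  exact closure_minimal (fun _ hy => le_csSup hbdd hy) isClosed_Iic
    (hc.image_closure (mem_image_of_mem _ hx))

/-- `Φ` is `C³` near the closed unit ball with `μ`-expanding gradient. -/
structure IsExpandingPhase {d : ℕ} (Φ : Euc d → ℝ) (U : Set (Euc d)) (μ : ℝ) : Prop where
  isOpen : IsOpen U
  subset : closedBall 0 1 ⊆ U
  contDiffOn : ContDiffOn ℝ (3 : ℕ) Φ U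
  pos : 0 < μ
  expanding : ∀ x ∈ closedBall (0 : Euc d) 1, ∀ y ∈ closedBall (0 : Euc d) 1,
    μ * ‖x - y‖ ≤ ‖gradient Φ x - gradient Φ y‖

namespace IsExpandingPhase

variable {d : ℕ} {Φ : Euc d → ℝ} {U : Set (Euc d)} {μ : ℝ}

lemma contDiffAt (h : IsExpandingPhase Φ U μ) {x : Euc d} (hx : x ∈ closedBall (0 : Euc d) 1) :
    ContDiffAt ℝ (3 : ℕ) Φ x :=
  h.contDiffOn.contDiffAt (h.isOpen.mem_nhds (h.subset hx))

lemma snd_fderiv_symm (h : IsExpandingPhase Φ U μ) {x : Euc d}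
    (hx : x ∈ closedBall (0 : Euc d) 1) (v w : Euc d) :
    fderiv ℝ (fderiv ℝ Φ) x v w = fderiv ℝ (fderiv ℝ Φ) x w v :=
  (h.contDiffAt hx).isSymmSndFDerivAt (by simp; norm_cast) v w

lemma hess_isHermitian (h : IsExpandingPhase Φ U μ) {x : Euc d}
    (hx : x ∈ closedBall (0 : Euc d) 1) : (Hess Φ x).IsHermitian := by
  ext i j
  simp [Hess, iteratedFDeriv_two_apply, h.snd_fderiv_symm hx (EuclideanSpace.single j 1)]

lemma hess_lipschitz (h : IsExpandingPhase Φ U μ) {x y : Euc d}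
    (hx : x ∈ closedBall (0 : Euc d) 1) (hy : y ∈ closedBall (0 : Euc d) 1) (w : Euc d) :
    ‖mulVecE (Hess Φ x) w - mulVecE (Hess Φ y) w‖ ≤
      supDeriv 3 Φ (ball 0 1) * ‖x - y‖ * ‖w‖ := by
  have hmv : ‖iteratedFDeriv ℝ 2 Φ x - iteratedFDeriv ℝ 2 Φ y‖ ≤
      supDeriv 3 Φ (ball 0 1) * ‖x - y‖ := by
    refine (convex_closedBall (0 : Euc d) 1).norm_image_sub_le_of_norm_fderiv_le (𝕜 := ℝ)
      (fun z hz => (h.contDiffAt hz).differentiableAt_iteratedFDeriv (by norm_cast))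
      (fun z hz => ?_) hy hx
    rw [norm_fderiv_iteratedFDeriv]
    exact norm_iteratedFDeriv_le_supDeriv h.isOpen h.subset h.contDiffOn le_rfl hz
  refine norm_le_of_inner_le (mul_nonneg ((norm_nonneg _).trans hmv) (norm_nonneg _)) fun v => ?_
  have := (iteratedFDeriv ℝ 2 Φ x - iteratedFDeriv ℝ 2 Φ y).le_opNorm ![v, w]
  simp only [sub_apply, iteratedFDeriv_two_apply, Fin.prod_univ_two,
    Matrix.cons_val_zero, Matrix.cons_val_one] at this
  rw [inner_sub_right, inner_mulVecE_hess, inner_mulVecE_hess]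
  refine (le_abs_self _).trans (this.trans ?_)
  calc _ ≤ supDeriv 3 Φ (ball 0 1) * ‖x - y‖ * (‖v‖ * ‖w‖) := by gcongr
    _ = _ := by ring

lemma norm_hess_le (h : IsExpandingPhase Φ U μ) {x : Euc d}
    (hx : x ∈ closedBall (0 : Euc d) 1) (w : Euc d) :
    ‖mulVecE (Hess Φ x) w‖ ≤ supDeriv 2 Φ (ball 0 1) * ‖w‖ := by
  refine norm_le_of_inner_le (mul_nonneg (supDeriv_nonneg _ _ _) (norm_nonneg _)) fun v => ?_
  have := (iteratedFDeriv ℝ 2 Φ x).le_opNorm ![v, w]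
  simp only [iteratedFDeriv_two_apply, Fin.prod_univ_two,
    Matrix.cons_val_zero, Matrix.cons_val_one] at this
  rw [inner_mulVecE_hess]
  refine (le_abs_self _).trans (this.trans ?_)
  calc _ ≤ supDeriv 2 Φ (ball 0 1) * (‖v‖ * ‖w‖) := by
        gcongr
        exact norm_iteratedFDeriv_le_supDeriv h.isOpen h.subset h.contDiffOn (by norm_num) hx
    _ = _ := by ring

lemma le_norm_hess (h : IsExpandingPhase Φ U μ) {x : Euc d}
    (hx : x ∈ closedBall (0 : Euc d) 1) (w : Euc d) : μ * ‖w‖ ≤ ‖mulVecE (Hess Φ x) w‖ := by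
  have hball : ∀ z ∈ ball (0 : Euc d) 1, μ * ‖w‖ ≤ ‖mulVecE (Hess Φ z) w‖ := by
    intro z hz
    have hzc := ball_subset_closedBall hz
    have hd : HasFDerivAt (fderiv ℝ Φ) (fderiv ℝ (fderiv ℝ Φ) z) z :=
      (((h.contDiffAt hzc).fderiv_right (m := 2) (by norm_cast)).differentiableAt
        (by norm_num)).hasFDerivAt
    have hline : HasDerivAt (fun t : ℝ => fderiv ℝ Φ (z + t • w)) (fderiv ℝ (fderiv ℝ Φ) z w) 0 := by
      have hl : HasDerivAt (fun t : ℝ => z + t • w) w 0 := by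
        simpa using ((hasDerivAt_id (0 : ℝ)).smul_const w).const_add z
      exact HasFDerivAt.comp_hasDerivAt (0 : ℝ) (by simpa using hd) hl
    have hslope := (hasDerivAt_iff_tendsto_slope_zero.mp hline).norm
    have hnear : ∀ᶠ t in nhdsWithin (0 : ℝ) {0}ᶜ, z + t • w ∈ ball (0 : Euc d) 1 := by
      have : ContinuousAt (fun t : ℝ => z + t • w) 0 := by fun_prop
      exact nhdsWithin_le_nhds (this.preimage_mem_nhds (isOpen_ball.mem_nhds (by simpa using hz)))
    have hlow : μ * ‖w‖ ≤ ‖fderiv ℝ (fderiv ℝ Φ) z w‖ := by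
      refine ge_of_tendsto hslope ?_
      filter_upwards [hnear, self_mem_nhdsWithin] with t ht ht0
      have hexp := h.expanding _ (ball_subset_closedBall ht) _ hzc
      rw [← (InnerProductSpace.toDual ℝ (Euc d)).norm_map (gradient _ _ - _), map_sub, toDual_gradient,
        toDual_gradient, add_sub_cancel_left, norm_smul] at hexp
      have hpos : 0 < ‖t‖ := norm_pos_iff.mpr ht0
      rw [zero_add, zero_smul, add_zero, norm_smul, norm_inv, inv_mul_eq_div, le_div_iff₀ hpos]
      linarith
    refine hlow.trans (ContinuousLinearMap.opNorm_le_bound _ (norm_nonneg _) fun v => ?_)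
    rw [h.snd_fderiv_symm hzc, ← inner_mulVecE_hess, mul_comm]
    exact norm_inner_le_norm _ _
  have hcont : ContinuousOn (fun z => ‖mulVecE (Hess Φ z) w‖) (closedBall 0 1) := by
    refine ContinuousOn.norm ?_
    refine LipschitzOnWith.continuousOn
      (K := Real.toNNReal (supDeriv 3 Φ (ball 0 1) * ‖w‖)) (LipschitzOnWith.of_dist_le_mul ?_)
    intro a ha b hb
    rw [dist_eq_norm, dist_eq_norm]
    refine (h.hess_lipschitz ha hb w).trans ?_
    rw [mul_right_comm]
    gcongr
    exact Real.le_coe_toNNReal _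
  rw [← closure_ball (0 : Euc d) one_ne_zero] at hx hcont
  exact closure_minimal (image_subset_iff.mpr hball) isClosed_Ici
    (hcont.image_closure (mem_image_of_mem _ hx))

end IsExpandingPhase

section InverseSqrt

variable {d : ℕ} {Φ : Euc d → ℝ} {U : Set (Euc d)} {μ : ℝ}

/-- The operator `S = T⁻¹ = |HΦ(x)|^{1/2}`: `S` is symmetric and `|S² w| = |HΦ(x) w|`. -/
lemma IsAbsInvSqrtHess.inv_properties {x : Euc d} {T : Matrix (Fin d) (Fin d) ℝ}
    (hT : IsAbsInvSqrtHess Φ x T) (hH : (Hess Φ x).IsHermitian) :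
    T⁻¹.IsHermitian ∧ T * T⁻¹ = 1 ∧ T⁻¹ * T = 1 ∧
      ∀ w : Euc d, ‖mulVecE (T⁻¹ * T⁻¹) w‖ = ‖mulVecE (Hess Φ x) w‖ := by
  obtain ⟨hpd, hHT⟩ := hT
  have hu : IsUnit T.det := hpd.isUnit.map Matrix.detMonoidHom
  have hr : T * T⁻¹ = 1 := Matrix.mul_nonsing_inv T hu
  have hl : T⁻¹ * T = 1 := Matrix.nonsing_inv_mul T hu
  have hSh : T⁻¹.IsHermitian := hpd.isHermitian.inv
  refine ⟨hSh, hr, hl, fun w => ?_⟩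
  have hSS : (T⁻¹ * T⁻¹).IsHermitian := by
    rw [Matrix.IsHermitian, Matrix.conjTranspose_mul, hSh.eq]
  have hsq : Hess Φ x * Hess Φ x = (T⁻¹ * T⁻¹) * (T⁻¹ * T⁻¹) := by
    have hinv : (T * T * T * T) * ((T⁻¹ * T⁻¹) * (T⁻¹ * T⁻¹)) = 1 := by
      have hcancel : ∀ A, T * (T⁻¹ * A) = A := fun A => by rw [← mul_assoc, hr, one_mul]
      simp only [mul_assoc, hcancel, hr]
    calc Hess Φ x * Hess Φ x
        = (Hess Φ x * Hess Φ x) * ((T * T * T * T) * ((T⁻¹ * T⁻¹) * (T⁻¹ * T⁻¹))) := by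
          rw [hinv, mul_one]
      _ = _ := by rw [← mul_assoc, hHT, one_mul]
  have hnorm : ∀ A : Matrix (Fin d) (Fin d) ℝ, A.IsHermitian →
      ‖mulVecE A w‖ ^ 2 = ⟪w, mulVecE (A * A) w⟫ := fun A hA => by
    rw [mulVecE_mul, ← inner_mulVecE_comm hA, real_inner_self_eq_norm_sq]
  rw [← sq_eq_sq₀ (norm_nonneg _) (norm_nonneg _), hnorm _ hSS, hnorm _ hH, hsq]

lemma norm_sq_mulVecE_le {c : ℝ} (hc : 0 ≤ c) {R S : Matrix (Fin d) (Fin d) ℝ}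
    (hR : R.IsHermitian) (hS : S.IsHermitian)
    (h : ∀ w : Euc d, ‖mulVecE (R * R) w‖ ≤ c * ‖mulVecE (S * S) w‖) (w : Euc d) :
    ‖mulVecE R w‖ ^ 2 ≤ c * ‖mulVecE S w‖ ^ 2 := by
  have hsm : ∀ v : Euc d, mulVecE (c • (S * S)) v = c • mulVecE (S * S) v := fun v => by
    ext i
    simp [mulVecE, Matrix.smul_mulVec]
  have hquad : ∀ A : Matrix (Fin d) (Fin d) ℝ, A.IsHermitian → ∀ v : Euc d,
      ⟪v, mulVecE (A * A) v⟫ = ‖mulVecE A v‖ ^ 2 := fun A hA v => by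
    rw [mulVecE_mul, ← inner_mulVecE_comm hA, real_inner_self_eq_norm_sq]
  have hsq : ∀ A : Matrix (Fin d) (Fin d) ℝ, A.IsHermitian → (A * A).IsHermitian :=
    fun A hA => by rw [Matrix.IsHermitian, Matrix.conjTranspose_mul, hA.eq]
  have hmain := inner_mulVecE_le_of_norm_le (P := R * R) (Q := c • (S * S)) (hsq R hR) ?_ ?_ ?_ w
  · rwa [hsm, inner_smul_right, hquad R hR, hquad S hS] at hmain
  · rw [Matrix.IsHermitian, Matrix.conjTranspose_smul, (hsq S hS).eq, star_trivial]
  · intro v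
    rw [hsm, inner_smul_right, hquad S hS]
    positivity
  · intro v
    rw [hsm, norm_smul, Real.norm_of_nonneg hc]
    exact h v

/-- `|HΦ(x)| ≥ μ` in the sense of quadratic forms. -/
lemma IsExpandingPhase.le_norm_sq_inv (h : IsExpandingPhase Φ U μ) {x : Euc d}
    (hx : x ∈ closedBall (0 : Euc d) 1) {T : Matrix (Fin d) (Fin d) ℝ}
    (hT : IsAbsInvSqrtHess Φ x T) (w : Euc d) : μ * ‖w‖ ^ 2 ≤ ‖mulVecE T⁻¹ w‖ ^ 2 := by
  obtain ⟨hS, -, -, hSH⟩ := hT.inv_properties (h.hess_isHermitian hx)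
  have hμ := h.pos
  have := norm_sq_mulVecE_le (c := μ⁻¹) (by positivity) Matrix.isHermitian_one hS (fun v => by
    rw [hSH, mul_one, mulVecE_one, le_inv_mul_iff₀ hμ]
    exact h.le_norm_hess hx v) w
  rwa [mulVecE_one, le_inv_mul_iff₀ hμ] at this

/-- `|HΦ(x)|` and `|HΦ(y)|` are comparable as soon as `x` and `y` are close. -/
lemma IsExpandingPhase.norm_sq_inv_le (h : IsExpandingPhase Φ U μ) {x y : Euc d}
    (hx : x ∈ closedBall (0 : Euc d) 1) (hy : y ∈ closedBall (0 : Euc d) 1)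
    {T T' : Matrix (Fin d) (Fin d) ℝ} (hT : IsAbsInvSqrtHess Φ x T)
    (hT' : IsAbsInvSqrtHess Φ y T')
    (hxy : supDeriv 3 Φ (ball 0 1) * ‖x - y‖ ≤ μ / 4) (w : Euc d) :
    ‖mulVecE T⁻¹ w‖ ^ 2 ≤ 5 / 4 * ‖mulVecE T'⁻¹ w‖ ^ 2 := by
  obtain ⟨hS, -, -, hSH⟩ := hT.inv_properties (h.hess_isHermitian hx)
  obtain ⟨hS', -, -, hSH'⟩ := hT'.inv_properties (h.hess_isHermitian hy)
  refine norm_sq_mulVecE_le (by norm_num) hS hS' (fun v => ?_) w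
  rw [hSH, hSH']
  have h1 := h.hess_lipschitz hx hy v
  have h2 := h.le_norm_hess hy v
  have h3 : supDeriv 3 Φ (ball 0 1) * ‖x - y‖ * ‖v‖ ≤ μ / 4 * ‖v‖ := by gcongr
  have h4 := norm_le_norm_add_norm_sub' (mulVecE (Hess Φ x) v) (mulVecE (Hess Φ y) v)
  linarith

end InverseSqrt

section Packet

variable {d : ℕ} {lam r : ℝ} {T : Matrix (Fin d) (Fin d) ℝ} {ν x : Euc d}

lemma mem_packet_iff (hlam : 0 < lam) (hr : T * T⁻¹ = 1) (hl : T⁻¹ * T = 1) :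
    x ∈ packet lam T ν r ↔ ‖mulVecE T⁻¹ (√lam • (x - ν))‖ < r := by
  have hs : √lam ≠ 0 := (Real.sqrt_pos.mpr hlam).ne'
  constructor
  · rintro ⟨y, hy, rfl⟩
    simpa [smul_smul, hs, ← mulVecE_mul, hl, mulVecE_one] using hy
  · intro hx
    refine ⟨mulVecE T⁻¹ (√lam • (x - ν)), by simpa using hx, ?_⟩
    simp [smul_smul, hs, ← mulVecE_mul, hr, mulVecE_one]

end Packet

lemma Pnorm_two {d : ℕ} (Φ : Euc d → ℝ) (s : Set (Euc d)) : Pnorm 2 Φ s = supDeriv 2 Φ s := by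
  simp [Pnorm]

lemma Pnorm_three {d : ℕ} (Φ : Euc d → ℝ) (s : Set (Euc d)) :
    Pnorm 3 Φ s = supDeriv 2 Φ s + supDeriv 3 Φ s := by
  simp [Pnorm, Finset.sum_Icc_succ_top]

lemma IsExpandingPhase.le_supDeriv_two {d : ℕ} (hd : 1 ≤ d) {Φ : Euc d → ℝ} {U : Set (Euc d)}
    {μ : ℝ} (h : IsExpandingPhase Φ U μ) : μ ≤ supDeriv 2 Φ (ball 0 1) := by
  have h0 : (0 : Euc d) ∈ closedBall (0 : Euc d) 1 := by simp
  have h1 := (h.le_norm_hess h0 (EuclideanSpace.single ⟨0, hd⟩ 1)).trans (h.norm_hess_le h0 _)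
  simpa using h1

lemma sixteen_mul_le {p₂ p₃ μ lam D : ℝ} (hμ : 0 < μ) (hp₂ : μ ≤ p₂) (hp₃ : 0 ≤ p₃) (hD : 1 ≤ D)
    (h : 2 ^ 8 * D * ((p₂ + p₃) ^ 2 * p₂ / μ ^ 4) ≤ lam) :
    0 < lam ∧ (16 * p₃) ^ 2 ≤ μ ^ 3 * lam := by
  have hp : 0 < p₂ := hμ.trans_le hp₂
  have hq : 0 < (p₂ + p₃) ^ 2 * p₂ / μ ^ 4 := by positivity
  have h1 : 2 ^ 8 * ((p₂ + p₃) ^ 2 * p₂ / μ ^ 4) ≤ lam := by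
    refine le_trans ?_ h
    rw [mul_assoc]
    gcongr
    exact le_mul_of_one_le_left hq.le hD
  refine ⟨by linarith, ?_⟩
  calc (16 * p₃) ^ 2 = 2 ^ 8 * p₃ ^ 2 := by ring
    _ ≤ 2 ^ 8 * ((p₂ + p₃) ^ 2 * (p₂ / μ)) := by
      have h2 : 1 ≤ p₂ / μ := (one_le_div hμ).mpr hp₂
      have h3 : p₃ ^ 2 ≤ (p₂ + p₃) ^ 2 := by gcongr; linarith
      gcongr
      exact h3.trans (le_mul_of_one_le_right (by positivity) h2)
    _ = μ ^ 3 * (2 ^ 8 * ((p₂ + p₃) ^ 2 * p₂ / μ ^ 4)) := by field_simp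
    _ ≤ _ := by gcongr

/-- Centers of doubled packets through a common point are close to each other. -/
lemma IsExpandingPhase.supDeriv_mul_dist_le {d : ℕ} {Φ : Euc d → ℝ} {U : Set (Euc d)} {μ lam : ℝ}
    (h : IsExpandingPhase Φ U μ) (hlam : 0 < lam)
    (hbig : (16 * supDeriv 3 Φ (ball 0 1)) ^ 2 ≤ μ ^ 3 * lam)
    {ν σ x : Euc d} (hν : ν ∈ closedBall (0 : Euc d) 1) (hσ : σ ∈ closedBall (0 : Euc d) 1)
    {T T' : Matrix (Fin d) (Fin d) ℝ} (hT : IsAbsInvSqrtHess Φ ν T)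
    (hT' : IsAbsInvSqrtHess Φ σ T') (hxν : x ∈ packet lam T ν 2) (hxσ : x ∈ packet lam T' σ 2) :
    supDeriv 3 Φ (ball 0 1) * ‖ν - σ‖ ≤ μ / 4 := by
  have hμ := h.pos
  set p := supDeriv 3 Φ (ball 0 1)
  have hp : 0 ≤ p := supDeriv_nonneg _ _ _
  have hdist : ∀ {τ : Euc d} {M : Matrix (Fin d) (Fin d) ℝ}, τ ∈ closedBall (0 : Euc d) 1 →
      IsAbsInvSqrtHess Φ τ M → x ∈ packet lam M τ 2 → p * ‖x - τ‖ ≤ μ / 8 := by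
    intro τ M hτ hM hx
    obtain ⟨-, hr, hl, -⟩ := hM.inv_properties (h.hess_isHermitian hτ)
    rw [mem_packet_iff hlam hr hl] at hx
    have h1 := h.le_norm_sq_inv hτ hM (√lam • (x - τ))
    have h2 : ‖mulVecE M⁻¹ (√lam • (x - τ))‖ ^ 2 ≤ 2 ^ 2 := by gcongr
    rw [norm_smul, Real.norm_of_nonneg (Real.sqrt_nonneg _), mul_pow, Real.sq_sqrt hlam.le] at h1
    have h3 : μ * lam * ‖x - τ‖ ^ 2 ≤ 4 := by linarith
    refine le_of_sq_le_sq ?_ (by positivity)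
    have h4 : (16 * p) ^ 2 * ‖x - τ‖ ^ 2 ≤ μ ^ 3 * lam * ‖x - τ‖ ^ 2 := by gcongr
    have h5 : μ ^ 2 * (μ * lam * ‖x - τ‖ ^ 2) ≤ μ ^ 2 * 4 := by gcongr
    nlinarith
  have h1 := hdist hν hT hxν
  have h2 := hdist hσ hT' hxσ
  have h3 : ‖ν - σ‖ ≤ ‖x - ν‖ + ‖x - σ‖ := by
    rw [norm_sub_rev x ν]
    exact norm_sub_le_norm_sub_add_norm_sub ν x σ
  have h4 : p * ‖ν - σ‖ ≤ p * (‖x - ν‖ + ‖x - σ‖) := by gcongr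
  linarith

end FiniteOverlap

open scoped Classical in
/-- Lemma `finiteoverlap`: for `λ ≥ λ₁ = 2⁸d⁸λ₀` with
`λ₀ = 𝒫₃²𝒫₂μ⁻⁴`, every point of `ℝ^d` lies in at most `N₀ = N₀(d)` of the doubled
ellipsoids `2B_ν = ν + λ^{-1/2}T_ν(B(0,2))`, `ν ∈ 𝓘_λ`, for any well-separated
collection `𝓘_λ`. -/
theorem stmt13 (d : ℕ) (hd : 1 ≤ d) :
    ∃ N₀ : ℕ,
      ∀ (lam : ℝ) (Φ : Euc d → ℝ) (U : Set (Euc d)) (μ : ℝ)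
        (T : Euc d → Matrix (Fin d) (Fin d) ℝ) (I : Finset (Euc d)),
        IsOpen U → closedBall 0 1 ⊆ U →
        ContDiffOn ℝ (3 : ℕ) Φ U →
        0 < μ →
        (∀ x ∈ closedBall (0 : Euc d) 1, ∀ y ∈ closedBall (0 : Euc d) 1,
          μ * ‖x - y‖ ≤ ‖gradient Φ x - gradient Φ y‖) →
        (∀ ν ∈ closedBall (0 : Euc d) 1, IsAbsInvSqrtHess Φ ν (T ν)) →
        2 ^ 8 * (d : ℝ) ^ 8 *
            (Pnorm 3 Φ (ball 0 1) ^ 2 * Pnorm 2 Φ (ball 0 1) / μ ^ 4) ≤ lam →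
        (I : Set (Euc d)) ⊆ closedBall 0 1 →
        (∀ ν ∈ I, ∀ σ ∈ I, ν ≠ σ →
          ν ∉ packet lam (T σ) σ 1 ∨ σ ∉ packet lam (T ν) ν 1) →
        ∀ x : Euc d, (I.filter fun ν => x ∈ packet lam (T ν) ν 2).card ≤ N₀ := by
  obtain ⟨N, hN⟩ := exists_card_le_of_separated (isCompact_closedBall (0 : Euc d) 3)
    (ε := 1 / 2) (by norm_num)
  refine ⟨N, fun lam Φ U μ T I hU hBU hΦ hμ hexp hT hlam hI hsep x => ?_⟩
  have h : IsExpandingPhase Φ U μ := ⟨hU, hBU, hΦ, hμ, hexp⟩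
  rw [Pnorm_two, Pnorm_three] at hlam
  obtain ⟨hlam0, hbig⟩ := sixteen_mul_le hμ (h.le_supDeriv_two hd) (supDeriv_nonneg _ _ _)
    (one_le_pow₀ (mod_cast hd)) hlam
  set J := I.filter fun ν => x ∈ packet lam (T ν) ν 2
  rcases J.eq_empty_or_nonempty with hemp | ⟨ν₀, hν₀⟩
  · simp [hemp]
  have hJI : ∀ ν ∈ J, ν ∈ I ∧ ν ∈ closedBall (0 : Euc d) 1 ∧ x ∈ packet lam (T ν) ν 2 := by
    intro ν hν
    obtain ⟨h1, h2⟩ := Finset.mem_filter.mp hν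
    exact ⟨h1, hI h1, h2⟩
  have hcomp : ∀ ν ∈ J, ∀ σ ∈ J, ∀ w : Euc d,
      ‖mulVecE (T ν)⁻¹ w‖ ^ 2 ≤ 5 / 4 * ‖mulVecE (T σ)⁻¹ w‖ ^ 2 := by
    intro ν hν σ hσ w
    obtain ⟨-, hνB, hxν⟩ := hJI ν hν
    obtain ⟨-, hσB, hxσ⟩ := hJI σ hσ
    exact h.norm_sq_inv_le hνB hσB (hT ν hνB) (hT σ hσB)
      (h.supDeriv_mul_dist_le hlam0 hbig hνB hσB (hT ν hνB) (hT σ hσB) hxν hxσ) w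
  have hmem : ∀ σ ∈ J, ∀ (r : ℝ) (y : Euc d),
      y ∈ packet lam (T σ) σ r ↔ ‖mulVecE (T σ)⁻¹ (√lam • (y - σ))‖ < r := by
    intro σ hσ r y
    have hσB := (hJI σ hσ).2.1
    obtain ⟨-, hr, hl, -⟩ := (hT σ hσB).inv_properties (h.hess_isHermitian hσB)
    exact mem_packet_iff hlam0 hr hl
  have hfar : ∀ ν ∈ J, ∀ σ ∈ J, ν ∉ packet lam (T σ) σ 1 →
      1 / 2 ≤ ‖mulVecE (T ν₀)⁻¹ (√lam • (ν - σ))‖ := by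
    intro ν _ σ hσ hνσ
    rw [hmem σ hσ, not_lt] at hνσ
    nlinarith [hcomp σ hσ ν₀ hν₀ (√lam • (ν - σ)),
      norm_nonneg (mulVecE (T ν₀)⁻¹ (√lam • (ν - σ)))]
  refine hN J (fun ν => mulVecE (T ν₀)⁻¹ (√lam • (x - ν))) (fun ν hν => ?_)
    (fun ν hν σ hσ hne => ?_)
  · have hx := (hmem ν hν 2 x).mp (hJI ν hν).2.2
    rw [mem_closedBall_zero_iff]
    nlinarith [hcomp ν₀ hν₀ ν hν (√lam • (x - ν)), norm_nonneg (mulVecE (T ν)⁻¹ (√lam • (x - ν))),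
      norm_nonneg (mulVecE (T ν₀)⁻¹ (√lam • (x - ν)))]
  · rw [dist_eq_norm, ← mulVecE_sub, ← smul_sub, sub_sub_sub_cancel_left]
    rcases hsep ν (hJI ν hν).1 σ (hJI σ hσ).1 hne with hout | hout
    · have := hfar ν hν σ hσ hout
      rwa [← neg_sub, smul_neg, ← neg_one_smul ℝ, mulVecE_smul, norm_smul, norm_neg, norm_one,
        one_mul]
    · exact hfar σ hσ ν hν hout

end
end
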